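/- arXiv:1504.04847 — 2 statements merged into one kernel-verified Lean document; each statement's English description precedes it below -/
import Mathlib

section
/- Let N ≥ 2 and let t be a real number with 0 ≤ t < N. Let u : ℝ^N → ℝ be continuously differentiable on ℝ^N \ {0}, and define v(x) := ((N-t)/N)^{(N-1)/N} · u(|x|^{t/(N-t)} x). Then v is continuously differentiable on ℝ^N \ {0}, satisfies the pointwise bound |∇v(x)| ≤ (N/(N-t))^{1/N} |x|^{t/(N-t)} |∇u(|x|^{t/(N-t)} x)| for all x ≠ 0, and consequently ∫_{ℝ^N} |∇v(x)|^N dx ≤ ∫_{ℝ^N} |∇u(y)|^N dy (as values in [0, ∞]). -/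
open MeasureTheory Real

section RadialPower

variable {E : Type*} [NormedAddCommGroup E] [InnerProductSpace ℝ E]

/-- The derivative of the radial map `x ↦ ‖x‖ ^ a • x`. -/
noncomputable def radialPowerDeriv (a : ℝ) (x : E) : E →L[ℝ] E :=
  ‖x‖ ^ a • (ContinuousLinearMap.id ℝ E + (a / ‖x‖ ^ 2) • (innerSL ℝ x).smulRight x)

lemma hasFDerivAt_norm_rpow_smul (a : ℝ) {x : E} (hx : x ≠ 0) :
    HasFDerivAt (fun y : E => ‖y‖ ^ a • y) (radialPowerDeriv a x) x := by
  have hpos : 0 < ‖x‖ := norm_pos_iff.mpr hx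
  have hsq : HasFDerivAt (fun y : E => ‖y‖ ^ 2) (2 • innerSL ℝ x) x :=
    (hasStrictFDerivAt_norm_sq x).hasFDerivAt
  have hpow := hsq.rpow_const (p := a / 2) (Or.inl (by positivity))
  have heq (y : E) : (‖y‖ ^ 2) ^ (a / 2) = ‖y‖ ^ a := by
    rw [← rpow_natCast_mul (norm_nonneg y)]
    congr 1
    push_cast
    ring
  have hcoef : (‖x‖ ^ 2) ^ (a / 2 - 1) = ‖x‖ ^ a / ‖x‖ ^ 2 := by
    rw [rpow_sub_one (by positivity), heq]
  rw [hcoef] at hpow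
  simp only [heq] at hpow
  refine (hpow.smul (hasFDerivAt_id x)).congr_fderiv ?_
  ext y
  simp [radialPowerDeriv, smul_smul]
  ring_nf

lemma norm_radialPowerDeriv_le {a : ℝ} (ha : 0 ≤ a) {x : E} (hx : x ≠ 0) :
    ‖radialPowerDeriv a x‖ ≤ (1 + a) * ‖x‖ ^ a := by
  have hpos : 0 < ‖x‖ := norm_pos_iff.mpr hx
  have hrank : ‖(a / ‖x‖ ^ 2) • (innerSL ℝ x).smulRight x‖ = a := by
    rw [norm_smul, ContinuousLinearMap.norm_smulRight_apply, innerSL_apply_norm,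
      norm_of_nonneg (by positivity)]
    field_simp
  rw [radialPowerDeriv, norm_smul, norm_of_nonneg (by positivity), mul_comm]
  gcongr
  refine (norm_add_le _ _).trans ?_
  rw [hrank]
  gcongr
  exact ContinuousLinearMap.norm_id_le

lemma det_radialPowerDeriv [FiniteDimensional ℝ E] (a : ℝ) {x : E} (hx : x ≠ 0) :
    (radialPowerDeriv a x).det = (1 + a) * (‖x‖ ^ a) ^ Module.finrank ℝ E := by
  have hpos : 0 < ‖x‖ := norm_pos_iff.mpr hx
  have hcoe : (radialPowerDeriv a x : E →ₗ[ℝ] E) = ‖x‖ ^ a •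
      LinearMap.transvection ((a / ‖x‖ ^ 2) • (innerSL ℝ x : E →ₗ[ℝ] ℝ)) x := by
    ext y
    simp [radialPowerDeriv, LinearMap.transvection.apply, smul_smul, mul_assoc]
  rw [ContinuousLinearMap.det, hcoe, LinearMap.det_smul, LinearMap.transvection.det, mul_comm]
  congr 2
  simp
  field_simp

lemma norm_norm_rpow_smul {a : ℝ} {x : E} (hx : x ≠ 0) :
    ‖‖x‖ ^ a • x‖ = ‖x‖ ^ (a + 1) := by
  rw [norm_smul, norm_of_nonneg (by positivity), rpow_add_one (norm_ne_zero_iff.mpr hx)]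

lemma injOn_norm_rpow_smul {a : ℝ} (ha : 0 ≤ a) :
    Set.InjOn (fun x : E => ‖x‖ ^ a • x) {0}ᶜ := by
  intro x hx y hy hxy
  simp only at hxy
  have hnorm : ‖x‖ = ‖y‖ := by
    have h := congrArg norm hxy
    rw [norm_norm_rpow_smul hx, norm_norm_rpow_smul hy] at h
    exact (rpow_left_inj (norm_nonneg x) (norm_nonneg y) (by positivity)).mp h
  rw [hnorm] at hxy
  exact smul_right_injective E (rpow_pos_of_pos (norm_pos_iff.mpr hy) a).ne' hxy

lemma norm_rpow_smul_ne_zero (a : ℝ) {x : E} (hx : x ≠ 0) : ‖x‖ ^ a • x ≠ 0 :=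
  smul_ne_zero (rpow_pos_of_pos (norm_pos_iff.mpr hx) a).ne' hx

lemma contDiffAt_norm_rpow_smul (a : ℝ) {n : WithTop ℕ∞} {x : E} (hx : x ≠ 0) :
    ContDiffAt ℝ n (fun y : E => ‖y‖ ^ a • y) x :=
  ((contDiffAt_norm ℝ hx).rpow_const_of_ne (norm_ne_zero_iff.mpr hx)).smul contDiffAt_id

lemma lintegral_radialPower_le [FiniteDimensional ℝ E] [MeasurableSpace E] [BorelSpace E]
    (μ : Measure E) [μ.IsAddHaarMeasure] [NullSingletonClass μ] {a : ℝ} (ha : 0 ≤ a)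
    (g : E → ENNReal) :
    ∫⁻ x, ENNReal.ofReal ((1 + a) * (‖x‖ ^ a) ^ Module.finrank ℝ E) * g (‖x‖ ^ a • x) ∂μ
      ≤ ∫⁻ y, g y ∂μ := by
  calc
    _ = ∫⁻ x in {0}ᶜ, ENNReal.ofReal |(radialPowerDeriv a x).det| * g (‖x‖ ^ a • x) ∂μ := by
      conv_lhs => rw [← restrict_compl_singleton (μ := μ) (0 : E)]
      refine setLIntegral_congr_fun (measurableSet_singleton 0).compl fun x hx => ?_
      simp only [det_radialPowerDeriv a hx]
      rw [abs_of_nonneg (by positivity)]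
    _ = ∫⁻ y in (fun x : E => ‖x‖ ^ a • x) '' {0}ᶜ, g y ∂μ :=
      (lintegral_image_eq_lintegral_abs_det_fderiv_mul μ (measurableSet_singleton 0).compl
        (fun x hx => (hasFDerivAt_norm_rpow_smul a hx).hasFDerivWithinAt)
        (injOn_norm_rpow_smul ha) g).symm
    _ ≤ _ := setLIntegral_le_lintegral _ _

end RadialPower

/-- **Gradient estimate under the change of variables (Section 2).** For `N ≥ 2`, `0 ≤ t < N`,
`u` continuously differentiable away from the origin and
`v(x) = ((N-t)/N)^{(N-1)/N} u(|x|^{t/(N-t)} x)`, the function `v` is `C¹` away from the origin,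
`|∇v(x)| ≤ (N/(N-t))^{1/N} |x|^{t/(N-t)} |∇u(|x|^{t/(N-t)} x)|` for `x ≠ 0`, and consequently
`∫ |∇v|^N dx ≤ ∫ |∇u|^N dy` (as values in `[0,∞]`). -/
theorem gradient_bound_change_of_variables (N : ℕ) (hN : 2 ≤ N) (t : ℝ) (ht0 : 0 ≤ t)
    (htN : t < (N : ℝ)) (u : EuclideanSpace ℝ (Fin N) → ℝ)
    (hu : ContDiffOn ℝ 1 u {(0 : EuclideanSpace ℝ (Fin N))}ᶜ)
    (v : EuclideanSpace ℝ (Fin N) → ℝ)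
    (hv : ∀ x, v x = (((N : ℝ) - t) / N) ^ (((N : ℝ) - 1) / N) *
      u (‖x‖ ^ (t / ((N : ℝ) - t)) • x)) :
    ContDiffOn ℝ 1 v {(0 : EuclideanSpace ℝ (Fin N))}ᶜ ∧
    (∀ x : EuclideanSpace ℝ (Fin N), x ≠ 0 →
      ‖fderiv ℝ v x‖ ≤ ((N : ℝ) / ((N : ℝ) - t)) ^ (1 / (N : ℝ)) * ‖x‖ ^ (t / ((N : ℝ) - t)) *
        ‖fderiv ℝ u (‖x‖ ^ (t / ((N : ℝ) - t)) • x)‖) ∧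
    (∫⁻ x, ENNReal.ofReal (‖fderiv ℝ v x‖ ^ (N : ℝ)))
      ≤ ∫⁻ y, ENNReal.ofReal (‖fderiv ℝ u y‖ ^ (N : ℝ)) := by
  have hN0 : (0 : ℝ) < N := by positivity
  have hNt : 0 < (N : ℝ) - t := sub_pos.mpr htN
  set a := t / ((N : ℝ) - t) with ha_def
  have ha : 0 ≤ a := by positivity
  have hone : 1 + a = (N : ℝ) / (N - t) := by
    rw [ha_def]
    field_simp
    ring
  have hbase : 0 < 1 + a := by positivity
  have hinv : ((N : ℝ) - t) / N = (1 + a)⁻¹ := by rw [hone, inv_div]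
  set c := (((N : ℝ) - t) / N) ^ (((N : ℝ) - 1) / N) with hc_def
  have hc : c * (1 + a) = (1 + a) ^ (1 / (N : ℝ)) := by
    rw [hc_def, hinv, inv_rpow hbase.le, ← rpow_neg hbase.le, ← rpow_add_one hbase.ne']
    congr 1
    field_simp
    ring
  have hc0 : 0 ≤ c := by positivity
  have hv' : v = fun x => c * u (‖x‖ ^ a • x) := funext hv
  have hu' {y : EuclideanSpace ℝ (Fin N)} (hy : y ≠ 0) : ContDiffAt ℝ 1 u y :=
    hu.contDiffAt (isOpen_compl_singleton.mem_nhds hy)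
  have hbound : ∀ x : EuclideanSpace ℝ (Fin N), x ≠ 0 → ‖fderiv ℝ v x‖ ≤
      ((N : ℝ) / (N - t)) ^ (1 / (N : ℝ)) * ‖x‖ ^ a * ‖fderiv ℝ u (‖x‖ ^ a • x)‖ := by
    intro x hx
    have hux := ((hu' (norm_rpow_smul_ne_zero a hx)).differentiableAt one_ne_zero).hasFDerivAt
    have hd : fderiv ℝ v x =
        c • (fderiv ℝ u (‖x‖ ^ a • x)).comp (radialPowerDeriv a x) := by
      rw [hv']
      exact ((HasFDerivAt.comp (f := fun y => ‖y‖ ^ a • y) x hux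
        (hasFDerivAt_norm_rpow_smul a hx)).const_mul c).fderiv
    rw [hd, norm_smul, norm_of_nonneg hc0, ← hone, ← hc]
    calc
      _ ≤ c * (‖fderiv ℝ u (‖x‖ ^ a • x)‖ * ((1 + a) * ‖x‖ ^ a)) := by
        gcongr
        refine (ContinuousLinearMap.opNorm_comp_le _ _).trans ?_
        gcongr
        exact norm_radialPowerDeriv_le ha hx
      _ = _ := by ring
  refine ⟨fun x hx => ?_, hbound, ?_⟩
  · rw [hv']
    exact (contDiffAt_const.mul (ContDiffAt.comp (f := fun y => ‖y‖ ^ a • y) x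
      (hu' (norm_rpow_smul_ne_zero a hx)) (contDiffAt_norm_rpow_smul a hx))).contDiffWithinAt
  · have : Nonempty (Fin N) := ⟨⟨0, by lia⟩⟩
    refine le_trans (lintegral_mono_ae ?_) (lintegral_radialPower_le volume ha
      fun y => ENNReal.ofReal (‖fderiv ℝ u y‖ ^ (N : ℝ)))
    filter_upwards [Measure.ae_ne volume (0 : EuclideanSpace ℝ (Fin N))] with x hx
    rw [← ENNReal.ofReal_mul (by positivity)]
    refine ENNReal.ofReal_le_ofReal ?_
    have h := rpow_le_rpow (norm_nonneg _) (hbound x hx) hN0.le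
    rw [mul_rpow (by positivity) (norm_nonneg _), mul_rpow (by positivity) (by positivity),
      ← hone, ← rpow_mul hbase.le, one_div_mul_cancel hN0.ne', rpow_one,
      rpow_natCast (‖x‖ ^ a)] at h
    simpa using h
end

section
/- Let N ≥ 2 and let β ∈ (0,1). Then there exists a constant C_β > 0 depending only on β and N such that the following holds: for every nondecreasing, locally absolutely continuous function w : ℝ → [0,∞) with w(t₀) = 0 for some t₀ ∈ ℝ and ∫_{-∞}^{∞} |w'(t)|^N dt ≤ 1, one has ∫_{-∞}^{∞} e^{β w(t)^{N/(N-1)}} w(t)^N e^{-t} dt ≤ C_β ∫_{-∞}^{∞} w(t)^N e^{-t} dt. -/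
open MeasureTheory Real

/-- A Hölder bound for increments of a function whose derivative has `L^p` norm at most one. -/
lemma sub_le_rpow_of_lintegral_rpow_le_one {p q : ℝ} (hpq : p.HolderConjugate q) {w w' : ℝ → ℝ}
    (hm : Measurable w') (hw : ∀ a b : ℝ, w b - w a = ∫ t in a..b, w' t)
    (h1 : (∫⁻ t, ENNReal.ofReal (|w' t| ^ p)) ≤ 1) {a b : ℝ} (hab : a ≤ b) :
    w b - w a ≤ (b - a) ^ (1 / q) := by
  have hba : 0 ≤ b - a := sub_nonneg.2 hab
  have hq : 0 ≤ 1 / q := one_div_nonneg.2 hpq.symm.nonneg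
  have hp : ∀ t, ‖w' t‖ₑ ^ p = ENNReal.ofReal (|w' t| ^ p) := fun t => by
    rw [Real.enorm_eq_ofReal_abs, ENNReal.ofReal_rpow_of_nonneg (abs_nonneg _) hpq.nonneg]
  have key : ‖w b - w a‖ₑ ≤ ENNReal.ofReal ((b - a) ^ (1 / q)) := by
    rw [hw a b, intervalIntegral.integral_of_le hab]
    calc ‖∫ t in Set.Ioc a b, w' t‖ₑ
        ≤ ∫⁻ t in Set.Ioc a b, ‖w' t‖ₑ := enorm_integral_le_lintegral_enorm _
      _ = ∫⁻ t in Set.Ioc a b, ((fun t => ‖w' t‖ₑ) * fun _ => (1 : ENNReal) : ℝ → ENNReal) t := by simp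
      _ ≤ (∫⁻ t in Set.Ioc a b, ‖w' t‖ₑ ^ p) ^ (1 / p) *
            (∫⁻ _ in Set.Ioc a b, 1 ^ q) ^ (1 / q) :=
          ENNReal.lintegral_mul_le_Lp_mul_Lq _ hpq hm.enorm.aemeasurable aemeasurable_const
      _ ≤ 1 ^ (1 / p) * (ENNReal.ofReal (b - a)) ^ (1 / q) := by
          gcongr
          · exact one_div_nonneg.2 hpq.nonneg
          · simp_rw [hp]
            exact (setLIntegral_le_lintegral _ _).trans h1
          · simp
      _ = ENNReal.ofReal ((b - a) ^ (1 / q)) := by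
          rw [ENNReal.one_rpow, one_mul, ENNReal.ofReal_rpow_of_nonneg hba hq]
  rw [Real.enorm_eq_ofReal_abs] at key
  exact (le_abs_self _).trans ((ENNReal.ofReal_le_ofReal_iff (by positivity)).1 key)

lemma Monotone.continuous_of_sub_le_rpow {w : ℝ → ℝ} (hmono : Monotone w) {r : ℝ} (hr : 0 < r)
    (h : ∀ a b, a ≤ b → w b - w a ≤ (b - a) ^ r) : Continuous w := by
  have habs : ∀ x y, |w y - w x| ≤ |y - x| ^ r := by
    intro x y
    rcases le_total x y with hxy | hxy
    · rw [abs_of_nonneg (sub_nonneg.2 (hmono hxy)), abs_of_nonneg (sub_nonneg.2 hxy)]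
      exact h x y hxy
    · rw [abs_sub_comm, abs_sub_comm y, abs_of_nonneg (sub_nonneg.2 (hmono hxy)),
        abs_of_nonneg (sub_nonneg.2 hxy)]
      exact h y x hxy
  refine continuous_iff_continuousAt.2 fun x => tendsto_iff_dist_tendsto_zero.2 ?_
  have hc : Continuous fun y : ℝ => |y - x| ^ r :=
    (by fun_prop : Continuous fun y : ℝ => |y - x|).rpow_const fun _ => Or.inr hr.le
  have h0 : Filter.Tendsto (fun y : ℝ => |y - x| ^ r) (nhds x) (nhds 0) := by
    simpa [Real.zero_rpow hr.ne'] using hc.tendsto x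
  exact squeeze_zero (fun _ => dist_nonneg) (fun y => habs x y) h0

/-- A convexity bound for the power of a sum with prescribed weight `l`. -/
lemma one_add_rpow_le {p l u : ℝ} (hp : 1 ≤ p) (hl0 : 0 < l) (hl1 : l < 1) (hu : 0 ≤ u) :
    (1 + u) ^ p ≤ l * (u / l) ^ p + (1 - l) * (1 / (1 - l)) ^ p := by
  have hl : 0 < 1 - l := sub_pos.2 hl1
  have h := (convexOn_rpow hp).2 (x := u / l) (y := 1 / (1 - l))
    (Set.mem_Ici.2 (by positivity)) (Set.mem_Ici.2 (by positivity)) hl0.le hl.le (by ring)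
  have e : l • (u / l) + (1 - l) • (1 / (1 - l)) = 1 + u := by
    simp only [smul_eq_mul]; field_simp; ring
  rw [e] at h
  simpa using h

/-- The nonlinear growth factor at `1 + s ^ (1 / p)` is dominated by a subunit exponential. -/
lemma exists_exp_mul_rpow_le {p : ℝ} (hp : 1 < p) (N : ℕ) {β : ℝ} (hβ0 : 0 < β) (hβ1 : β < 1) :
    ∃ K γ : ℝ, 0 < K ∧ γ < 1 ∧ ∀ s v : ℝ, 0 ≤ s → 1 ≤ v → v ≤ 1 + s ^ (1 / p) →
      exp (β * v ^ p) * v ^ (N : ℝ) ≤ K * exp (γ * s) := by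
  have hp0 : 0 < p := by linarith
  obtain ⟨b, hb, hb1⟩ := exists_between hβ1
  obtain ⟨c, hbc, hc1⟩ := exists_between hb1
  have hb0 : 0 < b := hβ0.trans hb
  have hc0 : 0 < c := hb0.trans hbc
  set l : ℝ := c ^ (1 / (p - 1)) with hl
  have hl0 : 0 < l := rpow_pos_of_pos hc0 _
  have hl1 : l < 1 := rpow_lt_one hc0.le hc1 (one_div_pos.2 (by linarith))
  have hlp : l ^ p = l * c := by
    have : l ^ (p - 1) = c := by
      rw [hl, ← rpow_mul hc0.le, one_div_mul_cancel (by linarith), rpow_one]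
    rw [← this, ← rpow_one_add' hl0.le (by linarith)]
    congr 1; ring
  set δ : ℝ := b - β with hδ
  have hδ0 : 0 < δ := sub_pos.2 hb
  set M : ℝ := (1 - l) * (1 / (1 - l)) ^ p
  refine ⟨(N.factorial / δ ^ N) * exp (b * M), b / c, by positivity, (div_lt_one hc0).2 hbc, ?_⟩
  intro s v hs hv hvs
  have hv0 : 0 ≤ v := by linarith
  have hpow : v ^ (N : ℝ) ≤ N.factorial / δ ^ N * exp (δ * v ^ p) := by
    rw [rpow_natCast]
    have h1 : (δ * v) ^ N / N.factorial ≤ exp (δ * v) :=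
      Real.pow_div_factorial_le_exp _ (by positivity) N
    have h2 : exp (δ * v) ≤ exp (δ * v ^ p) := by
      gcongr
      exact self_le_rpow_of_one_le hv hp.le
    have h3 := h1.trans h2
    rw [mul_pow, div_le_iff₀ (by positivity)] at h3
    rw [div_mul_eq_mul_div, le_div_iff₀ (by positivity)]
    linarith
  have hvp : v ^ p ≤ s / c + M := by
    have h1 : v ^ p ≤ (1 + s ^ (1 / p)) ^ p := rpow_le_rpow hv0 hvs hp0.le
    have h2 := one_add_rpow_le hp.le hl0 hl1 (rpow_nonneg hs (1 / p))
    have h3 : l * (s ^ (1 / p) / l) ^ p = s / c := by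
      rw [div_rpow (by positivity) hl0.le, ← rpow_mul hs, one_div_mul_cancel hp0.ne', rpow_one, hlp]
      field_simp
    rw [h3] at h2
    exact h1.trans h2
  calc exp (β * v ^ p) * v ^ (N : ℝ)
      ≤ exp (β * v ^ p) * (N.factorial / δ ^ N * exp (δ * v ^ p)) := by gcongr
    _ = N.factorial / δ ^ N * exp (b * v ^ p) := by
        rw [mul_left_comm, ← exp_add]; congr 2; rw [hδ]; ring
    _ ≤ N.factorial / δ ^ N * exp (b * (s / c + M)) := by gcongr
    _ = N.factorial / δ ^ N * exp (b * M) * exp (b / c * s) := by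
        rw [mul_assoc, ← exp_add]; congr 2; ring

lemma lintegral_Ioi_exp_neg_mul {a : ℝ} (ha : 0 < a) (T : ℝ) :
    (∫⁻ t in Set.Ioi T, ENNReal.ofReal (exp (-a * t))) = ENNReal.ofReal (exp (-a * T) / a) := by
  rw [← ofReal_integral_eq_lintegral_ofReal (integrableOn_exp_mul_Ioi (neg_lt_zero.2 ha) T)
    (Filter.Eventually.of_forall fun t => (exp_pos _).le),
    integral_exp_mul_Ioi (neg_lt_zero.2 ha) T]
  congr 1
  rw [neg_div_neg_eq]

/-- **One-dimensional inequality (3.8).** For `N ≥ 2` and `β ∈ (0,1)` there is `C_β > 0` such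
that for every nondecreasing, locally absolutely continuous `w : ℝ → [0,∞)` (encoded via a
derivative `w'` satisfying the fundamental theorem of calculus) with `w(t₀) = 0` for some `t₀`
and `∫ |w'|^N dt ≤ 1`, one has
`∫ e^{β w^{N/(N-1)}} w^N e^{-t} dt ≤ C_β ∫ w^N e^{-t} dt`. -/
theorem one_dim_moser_trudinger_exp (N : ℕ) (hN : 2 ≤ N) (β : ℝ) (hβ0 : 0 < β) (hβ1 : β < 1) :
    ∃ C : ℝ, 0 < C ∧
      ∀ w w' : ℝ → ℝ,
        Monotone w → (∀ t, 0 ≤ w t) → (∃ t₀, w t₀ = 0) →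
        Measurable w' →
        (∀ a b : ℝ, w b - w a = ∫ t in a..b, w' t) →
        (∫⁻ t, ENNReal.ofReal (|w' t| ^ (N : ℝ))) ≤ 1 →
        (∫⁻ t, ENNReal.ofReal
            (Real.exp (β * w t ^ ((N : ℝ) / ((N : ℝ) - 1))) * w t ^ (N : ℝ) * Real.exp (-t)))
          ≤ ENNReal.ofReal C * ∫⁻ t, ENNReal.ofReal (w t ^ (N : ℝ) * Real.exp (-t)) := by
  have hN1 : (1 : ℝ) < N := by exact_mod_cast hN
  set p : ℝ := (N : ℝ) / ((N : ℝ) - 1) with hpdef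
  have hpq : (N : ℝ).HolderConjugate p := Real.HolderConjugate.conjExponent hN1
  have hp : 1 < p := hpq.symm.lt
  have hp0 : 0 < p := hpq.symm.pos
  obtain ⟨K, γ, hK, hγ, hbound⟩ := exists_exp_mul_rpow_le hp N hβ0 hβ1
  have hγ' : 0 < 1 - γ := sub_pos.2 hγ
  refine ⟨exp β + K / (1 - γ), by positivity, ?_⟩
  rintro w w' hmono hnn ⟨t₀, ht₀⟩ hmeas hw h1
  have hinc : ∀ a b, a ≤ b → w b - w a ≤ (b - a) ^ (1 / p) := fun a b hab =>
    sub_le_rpow_of_lintegral_rpow_le_one hpq hmeas hw h1 hab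
  have hcont : Continuous w := hmono.continuous_of_sub_le_rpow (one_div_pos.2 hp0) hinc
  have hsmall : ∀ t, w t ≤ 1 → ENNReal.ofReal (exp (β * w t ^ p) * w t ^ (N : ℝ) * exp (-t)) ≤
      ENNReal.ofReal (exp β) * ENNReal.ofReal (w t ^ (N : ℝ) * exp (-t)) := by
    intro t ht
    rw [← ENNReal.ofReal_mul (exp_pos _).le, mul_assoc]
    have h2 : w t ^ p ≤ 1 := rpow_le_one (hnn t) ht hp0.le
    have h3 : 0 ≤ w t ^ (N : ℝ) := rpow_nonneg (hnn t) _
    gcongr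
    nlinarith
  rw [ENNReal.ofReal_add (by positivity) (by positivity), add_mul]
  by_cases hle : ∀ t, w t ≤ 1
  · refine le_trans ?_ le_self_add
    rw [← lintegral_const_mul' _ _ ENNReal.ofReal_ne_top]
    exact lintegral_mono fun t => hsmall t (hle t)
  push Not at hle
  obtain ⟨t₁, ht₁⟩ := hle
  obtain ⟨T, hT⟩ : ∃ T, w T = 1 :=
    mem_range_of_exists_le_of_exists_ge hcont ⟨t₀, by rw [ht₀]; exact zero_le_one⟩ ⟨t₁, ht₁.le⟩
  rw [← lintegral_add_compl _ (measurableSet_Iic (a := T)), Set.compl_Iic]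
  refine add_le_add ?_ ?_
  · rw [← lintegral_const_mul' _ _ ENNReal.ofReal_ne_top]
    exact (setLIntegral_mono' measurableSet_Iic fun t ht => hsmall t (hT ▸ hmono ht)).trans
      (setLIntegral_le_lintegral _ _)
  have hlower : ENNReal.ofReal (exp (-T)) ≤ ∫⁻ t, ENNReal.ofReal (w t ^ (N : ℝ) * exp (-t)) := by
    have h2 := lintegral_Ioi_exp_neg_mul one_pos T
    simp only [neg_mul, one_mul, div_one] at h2
    rw [← h2]
    refine (setLIntegral_mono' measurableSet_Ioi fun t ht => ?_).trans
      (setLIntegral_le_lintegral _ _)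
    have h3 : 1 ≤ w t := hT ▸ hmono (le_of_lt ht)
    exact ENNReal.ofReal_le_ofReal
      (le_mul_of_one_le_left (exp_pos _).le (one_le_rpow h3 (Nat.cast_nonneg N)))
  calc (∫⁻ t in Set.Ioi T, ENNReal.ofReal (exp (β * w t ^ p) * w t ^ (N : ℝ) * exp (-t)))
      ≤ ∫⁻ t in Set.Ioi T, ENNReal.ofReal (K * exp (-γ * T)) *
          ENNReal.ofReal (exp (-(1 - γ) * t)) := by
        refine setLIntegral_mono' measurableSet_Ioi fun t ht => ?_
        have ht' : T ≤ t := le_of_lt ht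
        have h3 := hinc T t ht'
        rw [hT] at h3
        have h4 := hbound (t - T) (w t) (sub_nonneg.2 ht') (hT ▸ hmono ht') (by linarith)
        rw [← ENNReal.ofReal_mul (by positivity)]
        refine ENNReal.ofReal_le_ofReal
          ((mul_le_mul_of_nonneg_right h4 (exp_pos _).le).trans_eq ?_)
        rw [mul_assoc, mul_assoc, ← exp_add, ← exp_add]
        ring_nf
    _ = ENNReal.ofReal (K / (1 - γ)) * ENNReal.ofReal (exp (-T)) := by
        rw [lintegral_const_mul' _ _ ENNReal.ofReal_ne_top, lintegral_Ioi_exp_neg_mul hγ',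
          ← ENNReal.ofReal_mul (by positivity), ← ENNReal.ofReal_mul (by positivity)]
        have h5 : exp (-T) = exp (-γ * T) * exp (-(1 - γ) * T) := by
          rw [← exp_add]; ring_nf
        rw [h5]
        ring_nf
    _ ≤ _ := by gcongr
end
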